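/- The Grigorchuk group G is commensurable with G × G: there exist a subgroup H₁ of G of finite index and a subgroup H₂ of G × G of finite index such that H₁ and H₂ are isomorphic as groups. -/

import Mathlib

namespace Grig

def aFun : List Bool → List Bool
  | [] => []
  | x :: v => (!x) :: v

mutual
  def bFun : List Bool → List Bool
    | [] => []
    | false :: v => false :: aFun v
    | true :: v => true :: cFun v
  def cFun : List Bool → List Bool
    | [] => []
    | false :: v => false :: aFun v
    | true :: v => true :: dFun v
  def dFun : List Bool → List Bool
    | [] => []
    | false :: v => false :: v
    | true :: v => true :: bFun v
end

theorem aFun_invol : Function.Involutive aFun := by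
  intro v; cases v <;> simp [aFun]

theorem bcd_invol : ∀ v, bFun (bFun v) = v ∧ cFun (cFun v) = v ∧ dFun (dFun v) = v := by
  intro v
  induction v with
  | nil => simp [bFun, cFun, dFun]
  | cons x v ih =>
    cases x <;> simp [bFun, cFun, dFun, aFun_invol v, ih.1, ih.2.1, ih.2.2]

/-- The automorphism `a` of the binary tree. -/
def a : Equiv.Perm (List Bool) := Function.Involutive.toPerm aFun aFun_invol

def b : Equiv.Perm (List Bool) := Function.Involutive.toPerm bFun (fun v => (bcd_invol v).1)

def c : Equiv.Perm (List Bool) := Function.Involutive.toPerm cFun (fun v => (bcd_invol v).2.1)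

def d : Equiv.Perm (List Bool) := Function.Involutive.toPerm dFun (fun v => (bcd_invol v).2.2)

/-- The Grigorchuk group, as the subgroup generated by `a, b, c, d` inside the
permutation group of the vertex set of the binary tree. -/
def grigG : Subgroup (Equiv.Perm (List Bool)) := Subgroup.closure {a, b, c, d}

end Grig

namespace Grig

def phiFun (g h : List Bool → List Bool) : List Bool → List Bool
  | [] => []
  | false :: v => false :: g v
  | true :: v => true :: h v

/-- The embedding of the square of the permutation group acting on the two subtrees. -/
def phi : Equiv.Perm (List Bool) × Equiv.Perm (List Bool) →* Equiv.Perm (List Bool) where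
  toFun p :=
    { toFun := phiFun p.1 p.2
      invFun := phiFun p.1.symm p.2.symm
      left_inv := by rintro (_ | ⟨_ | _, v⟩) <;> simp [phiFun]
      right_inv := by rintro (_ | ⟨_ | _, v⟩) <;> simp [phiFun] }
  map_one' := by
    ext1 v
    rcases v with (_ | ⟨_ | _, v⟩) <;> simp [phiFun]
  map_mul' p q := by
    ext1 v
    rcases v with (_ | ⟨_ | _, v⟩) <;> simp [phiFun]

theorem phi_apply (p) (v : List Bool) : phi p v = phiFun p.1 p.2 v := rfl

theorem phi_inj : Function.Injective phi := by
  rintro ⟨g, h⟩ ⟨g', h'⟩ e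
  have e' : ∀ v, phiFun g h v = phiFun g' h' v := fun v => DFunLike.congr_fun e v
  ext1
  · ext1 v
    simpa [phiFun] using e' (false :: v)
  · ext1 v
    simpa [phiFun] using e' (true :: v)

theorem a_app (v) : a v = aFun v := rfl
theorem b_app (v) : b v = bFun v := rfl
theorem c_app (v) : c v = cFun v := rfl
theorem d_app (v) : d v = dFun v := rfl

theorem b_eq : b = phi (a, c) := by
  ext1 v
  rcases v with (_ | ⟨_ | _, v⟩) <;> simp [phi_apply, phiFun, b_app, a_app, c_app, bFun]

theorem c_eq : c = phi (a, d) := by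
  ext1 v
  rcases v with (_ | ⟨_ | _, v⟩) <;> simp [phi_apply, phiFun, c_app, a_app, d_app, cFun]

theorem d_eq : d = phi (1, b) := by
  ext1 v
  rcases v with (_ | ⟨_ | _, v⟩) <;> simp [phi_apply, phiFun, b_app, d_app, dFun]

theorem a_phi (g h) : a * phi (g, h) = phi (h, g) * a := by
  ext1 v
  rcases v with (_ | ⟨_ | _, v⟩) <;> simp [phi_apply, phiFun, a_app, aFun]

theorem aa : a * a = 1 := by
  ext1 v; exact aFun_invol v
theorem bb : b * b = 1 := by
  ext1 v; exact (bcd_invol v).1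
theorem cc : c * c = 1 := by
  ext1 v; exact (bcd_invol v).2.1
theorem dd : d * d = 1 := by
  ext1 v; exact (bcd_invol v).2.2

theorem bcd_fun (v) : bFun (dFun v) = cFun v ∧ cFun (bFun v) = dFun v ∧ dFun (cFun v) = bFun v := by
  induction v with
  | nil => simp [bFun, cFun, dFun]
  | cons x v ih =>
    cases x <;> simp [bFun, cFun, dFun, aFun_invol v, ih.1, ih.2.1, ih.2.2]

theorem bd : b * d = c := by
  ext1 v; exact (bcd_fun v).1

theorem a_phi_a (g h) : a * phi (g, h) * a = phi (h, g) := by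
  rw [a_phi, mul_assoc, aa, mul_one]

theorem ha : a ∈ grigG := Subgroup.subset_closure (by simp)
theorem hb : b ∈ grigG := Subgroup.subset_closure (by simp)
theorem hc : c ∈ grigG := Subgroup.subset_closure (by simp)
theorem hd : d ∈ grigG := Subgroup.subset_closure (by simp)

theorem grig_ind {p : Equiv.Perm (List Bool) → Prop} (h1 : p 1)
    (pa : ∀ x ∈ grigG, p x → p (a * x)) (pb : ∀ x ∈ grigG, p x → p (b * x))
    (pc : ∀ x ∈ grigG, p x → p (c * x)) (pd : ∀ x ∈ grigG, p x → p (d * x)) :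
    ∀ x ∈ grigG, p x := by
  intro x hx
  induction hx using Subgroup.closure_induction_left with
  | one => exact h1
  | mul_left x hx y hy ih =>
    rcases hx with rfl | rfl | rfl | rfl
    exacts [pa y hy ih, pb y hy ih, pc y hy ih, pd y hy ih]
  | inv_mul_cancel x hx y hy ih =>
    rcases hx with rfl | rfl | rfl | rfl
    · rw [inv_eq_of_mul_eq_one_left aa]; exact pa y hy ih
    · rw [inv_eq_of_mul_eq_one_left bb]; exact pb y hy ih
    · rw [inv_eq_of_mul_eq_one_left cc]; exact pc y hy ih
    · rw [inv_eq_of_mul_eq_one_left dd]; exact pd y hy ih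

/-- Elements `g` of `G` acting on one subtree only and still in `G`. -/
def nSub : Subgroup grigG :=
  grigG.comap (phi.comp ((MonoidHom.inl _ _).comp grigG.subtype))

theorem mem_nSub (g : grigG) : g ∈ nSub ↔ phi (g.1, 1) ∈ grigG := Iff.rfl

theorem mem_nSub' (g : grigG) (h : g ∈ nSub) : phi (1, g.1) ∈ grigG := by
  rw [← a_phi_a]
  exact mul_mem (mul_mem ha h) ha

theorem conj_mem (s : Equiv.Perm (List Bool)) (t n) (hs : phi (s, t) ∈ grigG)
    (hn : phi (n, 1) ∈ grigG) : phi (s * n * s⁻¹, 1) ∈ grigG := by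
  have := mul_mem (mul_mem hs hn) (inv_mem hs)
  rw [← map_inv, ← map_mul, ← map_mul] at this
  simpa using this

theorem proj_one : ∀ g ∈ grigG, ∃ t, phi (g, t) ∈ grigG := by
  have key : ∀ s t, phi (s, t) ∈ grigG → ∀ x ∈ grigG, (∃ t, phi (x, t) ∈ grigG) →
      ∃ t, phi (s * x, t) ∈ grigG := by
    rintro s t hs x - ⟨u, hu⟩
    exact ⟨t * u, by simpa [← map_mul] using mul_mem hs hu⟩
  refine grig_ind ⟨1, ?_⟩ (key a c ?_) (key b 1 ?_) (key c a ?_) (key d a ?_)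
  · rw [show ((1 : Equiv.Perm (List Bool)), (1 : Equiv.Perm (List Bool))) = 1 from rfl, map_one]; exact one_mem _
  · exact b_eq ▸ hb
  · rw [← a_phi_a, ← d_eq]; exact mul_mem (mul_mem ha hd) ha
  · rw [← a_phi_a, ← b_eq]; exact mul_mem (mul_mem ha hb) ha
  · rw [← a_phi_a, ← c_eq]; exact mul_mem (mul_mem ha hc) ha

instance nSub_normal : nSub.Normal where
  conj_mem n hn g := by
    obtain ⟨t, ht⟩ := proj_one g.1 g.2
    exact conj_mem _ t _ ht hn

theorem b_mem : (⟨b, hb⟩ : grigG) ∈ nSub := by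
  rw [mem_nSub]
  show phi (b, 1) ∈ grigG
  rw [← a_phi_a, ← d_eq]; exact mul_mem (mul_mem ha hd) ha

theorem ad4 : (a * d) ^ 4 = 1 := by
  have h2 : (a * d) ^ 2 = phi (b, b) := by
    rw [pow_two, ← mul_assoc]
    nth_rewrite 1 [d_eq]
    rw [a_phi_a, d_eq, ← map_mul]; simp
  rw [show 4 = 2 * 2 from rfl, pow_mul, h2, pow_two, ← map_mul]
  rw [Prod.mk_mul_mk, bb]
  exact map_one phi

theorem nSub_fin : nSub.FiniteIndex := by
  let q := QuotientGroup.mk' nSub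
  let A : grigG ⧸ nSub := q ⟨a, ha⟩
  let D : grigG ⧸ nSub := q ⟨d, hd⟩
  have hB : q ⟨b, hb⟩ = 1 := (QuotientGroup.eq_one_iff _).2 b_mem
  have hC : q ⟨c, hc⟩ = D := by
    have : (⟨c, hc⟩ : grigG) = ⟨b, hb⟩ * ⟨d, hd⟩ := Subtype.ext bd.symm
    rw [this, map_mul, hB, one_mul]
  have hAA : A * A = 1 := by
    rw [← map_mul, ← map_one q]; exact congrArg q (Subtype.ext aa)
  have hDD : D * D = 1 := by
    rw [← map_mul, ← map_one q]; exact congrArg q (Subtype.ext dd)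
  have hAD : (A * D) ^ 4 = 1 := by
    rw [← map_mul, ← map_pow, ← map_one q]; exact congrArg q (Subtype.ext ad4)
  have hAi : A⁻¹ = A := inv_eq_of_mul_eq_one_left hAA
  have hDi : D⁻¹ = D := inv_eq_of_mul_eq_one_left hDD
  let Z := Subgroup.zpowers (A * D)
  have hZ : (Z : Set (grigG ⧸ nSub)).Finite :=
    (isOfFinOrder_iff_pow_eq_one.2 ⟨4, by norm_num, hAD⟩).finite_zpowers
  have ht : A * D ∈ Z := Subgroup.mem_zpowers _
  have ht' : D * A ∈ Z := by
    have := inv_mem ht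
    rwa [mul_inv_rev, hAi, hDi] at this
  have hpD : ∀ y : grigG ⧸ nSub, (y ∈ Z ∨ A * y ∈ Z) → (D * y ∈ Z ∨ A * (D * y) ∈ Z) := by
    rintro y (h | h)
    · right
      rw [← mul_assoc]; exact mul_mem ht h
    · left
      have := mul_mem ht' h
      rwa [mul_assoc, ← mul_assoc A A, hAA, one_mul] at this
  have main : ∀ x ∈ grigG, ∀ hx : x ∈ grigG, (q ⟨x, hx⟩ ∈ Z ∨ A * q ⟨x, hx⟩ ∈ Z) := by
    refine grig_ind ?_ ?_ ?_ ?_ ?_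
    · intro hx
      left
      have : (⟨1, hx⟩ : grigG) = 1 := rfl
      rw [this, map_one]; exact one_mem _
    · intro x hx ih h
      have : (⟨a * x, h⟩ : grigG) = ⟨a, ha⟩ * ⟨x, hx⟩ := rfl
      rw [this, map_mul]
      change A * _ ∈ Z ∨ A * (A * _) ∈ Z
      rw [← mul_assoc, hAA, one_mul]
      exact (ih hx).symm
    · intro x hx ih h
      have : (⟨b * x, h⟩ : grigG) = ⟨b, hb⟩ * ⟨x, hx⟩ := rfl
      rw [this, map_mul, hB, one_mul]
      exact ih hx
    · intro x hx ih h
      have : (⟨c * x, h⟩ : grigG) = ⟨c, hc⟩ * ⟨x, hx⟩ := rfl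
      rw [this, map_mul, hC]
      exact hpD _ (ih hx)
    · intro x hx ih h
      have : (⟨d * x, h⟩ : grigG) = ⟨d, hd⟩ * ⟨x, hx⟩ := rfl
      rw [this, map_mul]
      exact hpD _ (ih hx)
  have hfin : (Set.univ : Set (grigG ⧸ nSub)).Finite := by
    refine (hZ.union (hZ.image (fun y => A * y))).subset ?_
    intro y _
    obtain ⟨⟨x, hx⟩, rfl⟩ := QuotientGroup.mk'_surjective nSub y
    rcases main x hx hx with h | h
    · exact Or.inl h
    · refine Or.inr ⟨_, h, ?_⟩
      change A * (A * _) = _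
      rw [← mul_assoc, hAA, one_mul]
  have : Finite (grigG ⧸ nSub) := Set.finite_univ_iff.1 hfin
  exact Subgroup.finiteIndex_of_finite_quotient

def emb : grigG × grigG →* Equiv.Perm (List Bool) :=
  phi.comp (grigG.subtype.prodMap grigG.subtype)

theorem emb_inj : Function.Injective emb :=
  phi_inj.comp (Function.Injective.prodMap Subtype.val_injective Subtype.val_injective)

theorem split : ∀ x ∈ grigG, x ∈ emb.range ∨ a * x ∈ emb.range := by
  have key : ∀ (s t : Equiv.Perm (List Bool)) (hs : s ∈ grigG) (ht : t ∈ grigG), ∀ x ∈ grigG,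
      (x ∈ emb.range ∨ a * x ∈ emb.range) →
      (phi (s, t) * x ∈ emb.range ∨ a * (phi (s, t) * x) ∈ emb.range) := by
    rintro s t hs ht x - (h | h)
    · exact Or.inl (mul_mem ⟨(⟨s, hs⟩, ⟨t, ht⟩), rfl⟩ h)
    · right
      rw [← mul_assoc, a_phi, mul_assoc]
      exact mul_mem ⟨(⟨t, ht⟩, ⟨s, hs⟩), rfl⟩ h
  refine grig_ind (Or.inl (one_mem _)) ?_ ?_ ?_ ?_
  · intro x _ h
    rw [← mul_assoc, aa, one_mul]
    exact h.symm
  · rw [b_eq]; exact key _ _ ha hc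
  · rw [c_eq]; exact key _ _ ha hd
  · rw [d_eq]; exact key _ _ (one_mem _) hb

/-- The Grigorchuk group is commensurable with its square: there are a finite-index
subgroup of `G` and a finite-index subgroup of `G × G` which are isomorphic. -/
theorem grigG_commensurable_sq :
    ∃ (H₁ : Subgroup grigG) (H₂ : Subgroup (grigG × grigG)),
      H₁.FiniteIndex ∧ H₂.FiniteIndex ∧ Nonempty (H₁ ≃* H₂) := by
  let H₁ : Subgroup grigG := emb.range.subgroupOf grigG
  let H₂ : Subgroup (grigG × grigG) := grigG.comap emb
  refine ⟨H₁, H₂, ?_, ?_, ?_⟩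
  · have hfin : (Set.univ : Set (grigG ⧸ H₁)).Finite := by
      refine (Set.toFinite {((1 : grigG) : grigG ⧸ H₁), ((⟨a, ha⟩ : grigG) : grigG ⧸ H₁)}).subset ?_
      intro y _
      obtain ⟨⟨x, hx⟩, rfl⟩ := QuotientGroup.mk_surjective y
      rcases split x hx with h | h
      · left
        symm
        rw [QuotientGroup.eq, inv_one, one_mul]
        exact h
      · right
        refine Eq.symm (?_ : _ = _)
        rw [QuotientGroup.eq]
        change a⁻¹ * x ∈ emb.range
        rwa [inv_eq_of_mul_eq_one_left aa]
    have : Finite (grigG ⧸ H₁) := Set.finite_univ_iff.1 hfin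
    exact Subgroup.finiteIndex_of_finite_quotient
  · have := nSub_fin
    have hle : nSub.prod nSub ≤ H₂ := by
      rintro ⟨g, h⟩ ⟨hg, hh⟩
      have := mul_mem ((mem_nSub g).1 hg) (mem_nSub' h hh)
      change phi (g.1, 1) * phi (1, h.1) ∈ grigG at this
      rw [← map_mul, Prod.mk_mul_mk, mul_one, one_mul] at this
      exact this
    have : (nSub.prod nSub).FiniteIndex := ⟨by
      rw [Subgroup.index_prod]
      exact mul_ne_zero this.1 this.1⟩
    exact Subgroup.finiteIndex_of_le hle
  · let f : H₂ →* H₁ :=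
      { toFun := fun p => ⟨⟨emb p.1, p.2⟩, ⟨p.1, rfl⟩⟩
        map_one' := by ext1; ext1; exact map_one emb
        map_mul' := fun p q => by ext1; ext1; exact map_mul emb _ _ }
    refine ⟨(MulEquiv.ofBijective f ⟨?_, ?_⟩).symm⟩
    · intro p q h
      exact Subtype.ext (emb_inj (congrArg (fun z : H₁ => z.1.1) h))
    · rintro ⟨⟨x, hx⟩, hp⟩
      obtain ⟨p, hp'⟩ : ∃ p, emb p = x := hp
      subst hp'
      exact ⟨⟨p, hx⟩, rfl⟩

end Grig
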